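/- Second-moment bound for the entropy sample mean under Markov correlations: For k = 1,…,m let τ_k := ∑_{i∈I} γ_i σ_k(i), with spectral decomposition τ_k = ∑_{p=1}^d λ_{k,p} π_{k,p} (orthonormal eigenbasis, π_{k,p} rank-one). Set λ_k(i,i';p) := Tr(π_{k,p} σ_k(i,i')) and define the probability distribution P on {1,…,d}^m by P((p_1,…,p_m)) := ∑_{i_1,…,i_{m+1}∈I} γ_{i_1} ∏_{k=1}^m λ_k(i_k,i_{k+1};p_k). Assume conditions (i), (ii) and the upper domination bound σ_k(i,i') ≤ (1+δ³) γ_{i'} σ_k(i) for all k,i,i'. Then (with sums restricted to sequences of positive P-probability, on which λ_{k,p_k} > 0 for all k): ∑_{(p)} P((p)) · ( (1/m) ∑_{k=1}^m ( log₂ λ_{k,p_k} + S(τ_k) ) )² ≤ (1/m²) ∑_{k=1}^m ∑_{p : λ_{k,p}>0} λ_{k,p} (log₂ λ_{k,p})² + δ³ ( (1/m) ∑_{k=1}^m S(τ_k) )². -/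

import Mathlib

open scoped BigOperators ComplexOrder Matrix

/-- The rank-one projection `|v⟩⟨v|` onto a (unit) vector `v ∈ ℂ^d`. -/
noncomputable def outerProj {d : ℕ} (v : Fin d → ℂ) : Matrix (Fin d) (Fin d) ℂ :=
  Matrix.vecMulVec v (star v)

/-- The tensor product `A₁ ⊗ ⋯ ⊗ A_m` of `d × d` matrices, as a matrix on
`(ℂ^d)^{⊗m} ≃ ℂ^(Fin m → Fin d)`. -/
noncomputable def matTensor {m d : ℕ} (A : Fin m → Matrix (Fin d) (Fin d) ℂ) :
    Matrix (Fin m → Fin d) (Fin m → Fin d) ℂ :=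
  Matrix.of fun x y => ∏ k, A k (x k) (y k)

/-- The Markov-correlated state
`σ^{(m)} = ∑_{i₁,…,i_{m+1}} γ_{i₁} σ₁(i₁,i₂) ⊗ ⋯ ⊗ σ_m(i_m,i_{m+1})`. -/
noncomputable def sigmaChain {I : Type*} [Fintype I] {d m : ℕ} (γ : I → ℝ)
    (σ : Fin m → I → I → Matrix (Fin d) (Fin d) ℂ) :
    Matrix (Fin m → Fin d) (Fin m → Fin d) ℂ :=
  ∑ i : Fin (m + 1) → I,
    ((γ (i 0) : ℂ)) • matTensor (fun k => σ k (i k.castSucc) (i k.succ))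

/-- The measurement distribution
`P((p₁,…,p_m)) = ∑_{i₁,…,i_{m+1}} γ_{i₁} ∏ₖ λₖ(iₖ,i_{k+1}; pₖ)` with
`λₖ(i,i';p) = Tr(π_{k,p} σₖ(i,i'))`. -/
noncomputable def measP {I : Type*} [Fintype I] {d m : ℕ} (γ : I → ℝ)
    (σ : Fin m → I → I → Matrix (Fin d) (Fin d) ℂ)
    (π : Fin m → Fin d → Matrix (Fin d) (Fin d) ℂ) (p : Fin m → Fin d) : ℝ :=
  ∑ i : Fin (m + 1) → I,
    γ (i 0) * ∏ k, (Matrix.trace (π k (p k) * σ k (i k.castSucc) (i k.succ))).re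

/-- The Shannon entropy (base 2) of an eigenvalue list. -/
noncomputable def shannonEntropy {d : ℕ} (lam : Fin d → ℝ) : ℝ :=
  -∑ p, lam p * Real.logb 2 (lam p)

/-- Partition-function style chain sum. -/
noncomputable def chainZ {I : Type*} [Fintype I] {m : ℕ} (μ : I → ℝ)
    (B : Fin m → I → I → ℝ) : ℝ :=
  ∑ i : Fin (m + 1) → I, μ (i 0) * ∏ k, B k (i k.castSucc) (i k.succ)

theorem chainZ_zero {I : Type*} [Fintype I] (μ : I → ℝ) (B : Fin 0 → I → I → ℝ) :
    chainZ μ B = ∑ i, μ i := by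
  unfold chainZ
  simp only [Finset.univ_eq_empty, Finset.prod_empty, mul_one]
  exact Fintype.sum_equiv (Equiv.funUnique (Fin 1) I) _ _ (fun i => rfl)

theorem chainZ_succ {I : Type*} [Fintype I] {m : ℕ} (μ : I → ℝ)
    (B : Fin (m + 1) → I → I → ℝ) :
    chainZ μ B = chainZ (fun i' => ∑ i, μ i * B 0 i i') (fun k => B k.succ) := by
  unfold chainZ
  rw [← (Fin.consEquiv (fun _ : Fin (m + 2) => I)).sum_comp, Fintype.sum_prod_type,
    Finset.sum_comm]
  refine Finset.sum_congr rfl fun x _ => ?_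
  rw [Finset.sum_mul]
  refine Finset.sum_congr rfl fun y _ => ?_
  rw [Fin.prod_univ_succ]
  simp [Fin.consEquiv, mul_assoc]

theorem chainZ_mono {I : Type*} [Fintype I] {m : ℕ} {μ ν : I → ℝ}
    {B : Fin m → I → I → ℝ} (hB : ∀ k i i', 0 ≤ B k i i') (h : ∀ i, μ i ≤ ν i) :
    chainZ μ B ≤ chainZ ν B := by
  unfold chainZ
  exact Finset.sum_le_sum fun i _ =>
    mul_le_mul_of_nonneg_right (h _) (Finset.prod_nonneg fun k _ => hB _ _ _)

theorem chainZ_smul {I : Type*} [Fintype I] {m : ℕ} (c : ℝ) (μ : I → ℝ)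
    (B : Fin m → I → I → ℝ) : chainZ (fun i => c * μ i) B = c * chainZ μ B := by
  unfold chainZ
  rw [Finset.mul_sum]
  exact Finset.sum_congr rfl fun i _ => by ring

theorem chainZ_row {I : Type*} [Fintype I] {m : ℕ} (μ : I → ℝ)
    (B : Fin m → I → I → ℝ) (hrow : ∀ j i, ∑ i', B j i i' = 1) :
    chainZ μ B = ∑ i, μ i := by
  induction m generalizing μ with
  | zero => exact chainZ_zero μ B
  | succ m ih =>
    rw [chainZ_succ, ih _ _ (fun j => hrow j.succ), Finset.sum_comm]
    refine Finset.sum_congr rfl fun i _ => ?_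
    rw [← Finset.mul_sum, hrow, mul_one]

theorem chainZ_one {I : Type*} [Fintype I] {m : ℕ} (γ : I → ℝ)
    (B : Fin m → I → I → ℝ) (k : Fin m)
    (hrow : ∀ j, j ≠ k → ∀ i, ∑ i', B j i i' = 1)
    (hst : ∀ j, j ≠ k → ∀ i', ∑ i, γ i * B j i i' = γ i') :
    chainZ γ B = ∑ i, γ i * ∑ i', B k i i' := by
  induction m with
  | zero => exact k.elim0
  | succ m ih =>
    rw [chainZ_succ]
    refine Fin.cases (motive := fun k => (∀ j, j ≠ k → ∀ i, ∑ i', B j i i' = 1) →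
      (∀ j, j ≠ k → ∀ i', ∑ i, γ i * B j i i' = γ i') → _ = ∑ i, γ i * ∑ i', B k i i')
      ?_ ?_ k hrow hst
    · intro hrow hst
      rw [chainZ_row _ _ (fun j => hrow _ (Fin.succ_ne_zero j)), Finset.sum_comm]
      exact Finset.sum_congr rfl fun i _ => by rw [Finset.mul_sum]
    · intro k hrow hst
      have h0 : (fun i' => ∑ i, γ i * B 0 i i') = γ :=
        funext (hst 0 (Fin.succ_ne_zero k).symm)
      rw [h0]
      exact ih (fun j => B j.succ) k
        (fun j hj => hrow _ (fun h => hj (Fin.succ_injective _ h)))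
        (fun j hj => hst _ (fun h => hj (Fin.succ_injective _ h)))

theorem chainZ_two {I : Type*} [Fintype I] {m : ℕ} (γ : I → ℝ) (hγ : ∀ i, 0 ≤ γ i) (c : ℝ)
    (B : Fin m → I → I → ℝ) (hB : ∀ k i i', 0 ≤ B k i i') (k l : Fin m) (hkl : k < l)
    (hrow : ∀ j, j ≠ k → j ≠ l → ∀ i, ∑ i', B j i i' = 1)
    (hst : ∀ j, j ≠ k → j ≠ l → ∀ i', ∑ i, γ i * B j i i' = γ i')
    (hdom : ∀ i i', B k i i' ≤ c * γ i' * ∑ i'', B k i i'') :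
    chainZ γ B ≤ c * (∑ i, γ i * ∑ i', B k i i') * (∑ i, γ i * ∑ i', B l i i') := by
  induction m with
  | zero => exact k.elim0
  | succ m ih =>
    rw [chainZ_succ]
    obtain ⟨l, rfl⟩ := Fin.exists_succ_eq.2 (Fin.ne_zero_of_lt hkl)
    rcases Fin.eq_zero_or_eq_succ k with rfl | ⟨k, rfl⟩
    · have h1 : chainZ (fun i' => ∑ i, γ i * B 0 i i') (fun k => B k.succ) ≤
          chainZ (fun i' => (c * (∑ i, γ i * ∑ i', B 0 i i')) * γ i') (fun k => B k.succ) := by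
        refine chainZ_mono (fun k => hB _) fun i' => ?_
        rw [Finset.mul_sum, Finset.sum_mul]
        refine Finset.sum_le_sum fun i _ => ?_
        calc _ ≤ γ i * (c * γ i' * ∑ i'', B 0 i i'') :=
              mul_le_mul_of_nonneg_left (hdom _ _) (hγ _)
          _ = _ := by ring
      refine h1.trans (le_of_eq ?_)
      rw [chainZ_smul, chainZ_one γ (fun k => B k.succ) l
        (fun j hj => hrow _ (Fin.succ_ne_zero j) (fun h => hj (Fin.succ_injective _ h)))
        (fun j hj => hst _ (Fin.succ_ne_zero j) (fun h => hj (Fin.succ_injective _ h)))]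
    · have h0 : (fun i' => ∑ i, γ i * B 0 i i') = γ :=
        funext (hst 0 (Fin.succ_ne_zero k).symm (Fin.succ_ne_zero l).symm)
      rw [h0]
      exact ih (fun j => B j.succ) (fun j => hB _) k l (Fin.succ_lt_succ_iff.1 hkl)
        (fun j hj hj' => hrow _ (fun h => hj (Fin.succ_injective _ h))
          (fun h => hj' (Fin.succ_injective _ h)))
        (fun j hj hj' => hst _ (fun h => hj (Fin.succ_injective _ h))
          (fun h => hj' (Fin.succ_injective _ h))) hdom

/-- Weighted sums over outcomes. -/
theorem sum_weights {I : Type*} [Fintype I] {d m : ℕ} (γ : I → ℝ)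
    (a : Fin m → I → I → Fin d → ℝ) (w : Fin m → Fin d → ℝ) :
    ∑ p : Fin m → Fin d, (∑ i : Fin (m + 1) → I,
      γ (i 0) * ∏ k, a k (i k.castSucc) (i k.succ) (p k)) * ∏ k, w k (p k) =
    chainZ γ (fun k i i' => ∑ r, a k i i' r * w k r) := by
  unfold chainZ
  simp_rw [Finset.sum_mul]
  rw [Finset.sum_comm]
  refine Finset.sum_congr rfl fun i _ => ?_
  rw [Finset.prod_univ_sum, Finset.mul_sum, Fintype.piFinset_univ]
  refine Finset.sum_congr rfl fun p _ => ?_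
  rw [Finset.prod_mul_distrib, mul_assoc]

/-- The abstract (classical) second moment bound. -/
theorem classical_bound {I : Type*} [Fintype I] {d m : ℕ} (γ : I → ℝ)
    (hγ0 : ∀ i, 0 ≤ γ i) (hγ1 : ∑ i, γ i = 1) (ε : ℝ) (hε : 0 ≤ ε)
    (a : Fin m → I → I → Fin d → ℝ) (ha : ∀ k i i' r, 0 ≤ a k i i' r)
    (lam f : Fin m → Fin d → ℝ) (hf : ∀ k r, 0 ≤ f k r)
    (A1 : ∀ k i, ∑ i', ∑ r, a k i i' r = 1)
    (A2 : ∀ k i', ∑ i, γ i * ∑ r, a k i i' r = γ i')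
    (A3 : ∀ k i i' r, a k i i' r ≤ (1 + ε) * γ i' * ∑ i'', a k i i'' r)
    (A4 : ∀ k r, ∑ i, γ i * ∑ i', a k i i' r = lam k r) (P : (Fin m → Fin d) → ℝ)
    (hP : ∀ p, P p = ∑ i : Fin (m + 1) → I,
      γ (i 0) * ∏ k, a k (i k.castSucc) (i k.succ) (p k)) :
    ∑ p, P p * (∑ k, (∑ r, lam k r * f k r - f k (p k))) ^ 2 ≤
      ∑ k, ∑ r, lam k r * f k r ^ 2 + ε * (∑ k, ∑ r, lam k r * f k r) ^ 2 := by
  have hw : ∀ w : Fin m → Fin d → ℝ, ∑ p, P p * ∏ k, w k (p k) =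
      chainZ γ (fun k i i' => ∑ r, a k i i' r * w k r) := by
    intro w
    rw [← sum_weights]
    exact Finset.sum_congr rfl fun p _ => by rw [hP]
  have hmarg : ∀ k (g : Fin d → ℝ), ∑ i, γ i * ∑ i', ∑ r, a k i i' r * g r =
      ∑ r, lam k r * g r := by
    intro k g
    simp_rw [← A4, Finset.mul_sum, Finset.sum_mul]
    calc _ = ∑ i, ∑ r, ∑ i', γ i * (a k i i' r * g r) :=
          Finset.sum_congr rfl fun i _ => Finset.sum_comm
      _ = _ := by
        rw [Finset.sum_comm]
        simp_rw [mul_assoc]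
  have E0 : ∑ p, P p = 1 := by
    have := hw (fun _ _ => 1)
    simp only [Finset.prod_const_one, mul_one] at this
    rw [this, chainZ_row _ _ A1, hγ1]
  have E1 : ∀ k (g : Fin d → ℝ), ∑ p, P p * g (p k) = ∑ r, lam k r * g r := by
    intro k g
    have h := hw (Function.update (fun _ _ => 1) k g)
    have h2 : ∀ p : Fin m → Fin d,
        ∏ j, (Function.update (fun _ _ => 1) k g : Fin m → Fin d → ℝ) j (p j) = g (p k) := by
      intro p
      rw [Finset.prod_eq_single k]
      · simp
      · intro j _ hj; simp [Function.update_of_ne hj]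
      · simp
    simp_rw [h2] at h
    rw [h, chainZ_one γ _ k]
    · simp only [Function.update_self]; exact hmarg k g
    · intro j hj; simpa [Function.update_of_ne hj] using A1 j
    · intro j hj; simpa [Function.update_of_ne hj] using A2 j
  have E2 : ∀ k l, k < l → ∑ p, P p * (f k (p k) * f l (p l)) ≤
      (1 + ε) * (∑ r, lam k r * f k r) * (∑ r, lam l r * f l r) := by
    intro k l hkl
    set w : Fin m → Fin d → ℝ := fun j => if j = k ∨ j = l then f j else fun _ => 1 with hwdef
    have wk : w k = f k := by simp [hwdef]
    have wl : w l = f l := by simp [hwdef]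
    have wj : ∀ j, j ≠ k → j ≠ l → w j = fun _ => 1 := by
      intro j h1 h2; simp [hwdef, h1, h2]
    have w0 : ∀ j r, 0 ≤ w j r := by
      intro j r
      simp only [hwdef]
      split_ifs
      · exact hf _ _
      · exact zero_le_one
    have h := hw w
    have h2 : ∀ p : Fin m → Fin d, ∏ j, w j (p j) = f k (p k) * f l (p l) := by
      intro p
      rw [Finset.prod_eq_mul k l hkl.ne]
      · rw [wk, wl]
      · intro j _ hj; rw [wj j hj.1 hj.2]
      · simp
      · simp
    simp_rw [h2] at h
    rw [h]
    refine (chainZ_two γ hγ0 (1 + ε) _ ?_ k l hkl ?_ ?_ ?_).trans (le_of_eq ?_)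
    · exact fun j i i' => Finset.sum_nonneg fun r _ => mul_nonneg (ha _ _ _ _) (w0 _ _)
    · intro j h1 h2; simpa [wj j h1 h2] using A1 j
    · intro j h1 h2; simpa [wj j h1 h2] using A2 j
    · intro i i'
      rw [Finset.sum_comm, Finset.mul_sum]
      refine Finset.sum_le_sum fun r _ => ?_
      rw [← Finset.sum_mul, ← mul_assoc]
      exact mul_le_mul_of_nonneg_right (A3 _ _ _ _) (w0 _ _)
    · simp only [wk, wl, hmarg]
  set S : Fin m → ℝ := fun k => ∑ r, lam k r * f k r with hS
  set V : Fin m → ℝ := fun k => ∑ r, lam k r * f k r ^ 2 with hV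
  have E2' : ∀ k l, k ≠ l → ∑ p, P p * (f k (p k) * f l (p l)) ≤ (1 + ε) * S k * S l := by
    intro k l h
    rcases lt_or_gt_of_ne h with h | h
    · exact E2 k l h
    · have := E2 l k h
      calc _ = ∑ p, P p * (f l (p l) * f k (p k)) :=
            Finset.sum_congr rfl fun p _ => by ring
        _ ≤ _ := this
        _ = _ := by simp only [hS]; ring
  have Ecov : ∀ k l, ∑ p, P p * ((S k - f k (p k)) * (S l - f l (p l))) ≤
      (if k = l then V k else 0) + ε * (S k * S l) := by
    intro k l
    have hexp : ∑ p, P p * ((S k - f k (p k)) * (S l - f l (p l))) =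
        ∑ p, P p * (f k (p k) * f l (p l)) - S k * S l := by
      have : ∀ p, P p * ((S k - f k (p k)) * (S l - f l (p l))) =
          S k * S l * P p - S k * (P p * f l (p l)) - S l * (P p * f k (p k)) +
            P p * (f k (p k) * f l (p l)) := fun p => by ring
      simp_rw [this, Finset.sum_add_distrib, Finset.sum_sub_distrib, ← Finset.mul_sum]
      rw [E0, E1 l (f l), E1 k (f k)]
      simp only [hS]; ring
    rw [hexp]
    split_ifs with h
    · subst h
      have := E1 k (fun r => f k r ^ 2)
      have h2 : ∑ p, P p * (f k (p k) * f k (p k)) = V k := by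
        simp only [hV]
        rw [← this]
        exact Finset.sum_congr rfl fun p _ => by ring
      rw [h2]
      nlinarith [mul_self_nonneg (S k), mul_nonneg hε (mul_self_nonneg (S k))]
    · have := E2' k l h
      linarith
  calc ∑ p, P p * (∑ k, (S k - f k (p k))) ^ 2
      = ∑ k, ∑ l, ∑ p, P p * ((S k - f k (p k)) * (S l - f l (p l))) := by
        simp_rw [sq, Finset.sum_mul_sum, Finset.mul_sum]
        rw [Finset.sum_comm]
        exact Finset.sum_congr rfl fun k _ => Finset.sum_comm
    _ ≤ ∑ k, ∑ l, ((if k = l then V k else 0) + ε * (S k * S l)) :=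
        Finset.sum_le_sum fun k _ => Finset.sum_le_sum fun l _ => Ecov k l
    _ = _ := by
        simp_rw [Finset.sum_add_distrib, sq (∑ k, S k), Finset.sum_mul_sum, Finset.mul_sum]
        simp

theorem trace_outerProj_mul {d : ℕ} (v : Fin d → ℂ) (A : Matrix (Fin d) (Fin d) ℂ) :
    Matrix.trace (outerProj v * A) = star v ⬝ᵥ (A *ᵥ v) := by
  rw [outerProj, Matrix.vecMulVec_mul, Matrix.trace_vecMulVec, dotProduct_comm,
    Matrix.dotProduct_mulVec]

theorem sum_outerProj {d : ℕ} (e : Fin d → Fin d → ℂ)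
    (horth : ∀ p q, (star (e p)) ⬝ᵥ e q = if p = q then 1 else 0) :
    ∑ r, outerProj (e r) = 1 := by
  let E : Matrix (Fin d) (Fin d) ℂ := Matrix.of fun i r => e r i
  have h1 : Eᴴ * E = 1 := by
    ext p q
    rw [Matrix.one_apply, ← horth p q]
    simp [E, Matrix.mul_apply, dotProduct, Matrix.conjTranspose_apply]
  have h2 : E * Eᴴ = 1 := mul_eq_one_comm.1 h1
  rw [← h2]
  ext i j
  simp [E, Matrix.mul_apply, outerProj, Matrix.sum_apply, Matrix.vecMulVec_apply]

/-- Second-moment bound for the entropy sample mean under Markov correlations: if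
`τ_k = ∑ᵢ γᵢ σ_k(i)` has spectral decomposition `τ_k = ∑ₚ λ_{k,p} π_{k,p}` and the upper
domination bound holds, then the second moment of
`(1/m) ∑ₖ (log₂ λ_{k,p_k} + S(τ_k))` under `P` is at most
`(1/m²) ∑ₖ ∑_{p : λ_{k,p}>0} λ_{k,p} (log₂ λ_{k,p})² + δ³ ((1/m) ∑ₖ S(τ_k))²`. -/
theorem measP_second_moment_bound {I : Type*} [Fintype I] {d m : ℕ}
    (γ : I → ℝ) (hγ0 : ∀ i, 0 ≤ γ i) (hγ1 : ∑ i, γ i = 1) (δ : ℝ) (hδ : 0 < δ)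
    (σ : Fin m → I → I → Matrix (Fin d) (Fin d) ℂ)
    (hpsd : ∀ k i i', (σ k i i').PosSemidef)
    (hi : ∀ k i', ∑ i, (γ i : ℂ) * Matrix.trace (σ k i i') = (γ i' : ℂ))
    (hii : ∀ k i, Matrix.trace (∑ i', σ k i i') = 1)
    (hdom : ∀ k i i',
      ((((1 + δ ^ 3) * γ i' : ℝ) : ℂ) • (∑ i'', σ k i i'') - σ k i i').PosSemidef)
    (e : Fin m → Fin d → Fin d → ℂ) (lam : Fin m → Fin d → ℝ)
    (horth : ∀ k p q, (star (e k p)) ⬝ᵥ e k q = if p = q then 1 else 0)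
    (hspec : ∀ k, ∑ i, (γ i : ℂ) • ∑ i', σ k i i' =
      ∑ p, (lam k p : ℂ) • outerProj (e k p)) :
    ∑ p ∈ Finset.univ.filter fun p : Fin m → Fin d =>
        0 < measP γ σ (fun k r => outerProj (e k r)) p,
      measP γ σ (fun k r => outerProj (e k r)) p *
        ((1 / m) * ∑ k, (Real.logb 2 (lam k (p k)) + shannonEntropy (lam k))) ^ 2 ≤
    (1 / (m : ℝ) ^ 2) *
        (∑ k, ∑ q ∈ Finset.univ.filter fun q : Fin d => 0 < lam k q,
          lam k q * Real.logb 2 (lam k q) ^ 2) +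
      δ ^ 3 * ((1 / m) * ∑ k, shannonEntropy (lam k)) ^ 2 := by
  set a : Fin m → I → I → Fin d → ℝ :=
    fun k i i' r => (Matrix.trace (outerProj (e k r) * σ k i i')).re with hadef
  have tr_nonneg : ∀ (v : Fin d → ℂ) (A : Matrix (Fin d) (Fin d) ℂ), A.PosSemidef →
      0 ≤ (Matrix.trace (outerProj v * A)).re := by
    intro v A hA
    rw [trace_outerProj_mul]
    exact (Complex.le_def.1 (hA.dotProduct_mulVec_nonneg v)).1
  have ha : ∀ k i i' r, 0 ≤ a k i i' r := fun k i i' r => tr_nonneg _ _ (hpsd k i i')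
  have hsum : ∀ k i i', ∑ r, a k i i' r = (Matrix.trace (σ k i i')).re := by
    intro k i i'
    simp only [hadef]
    rw [← Complex.re_sum, ← Matrix.trace_sum, ← Finset.sum_mul, sum_outerProj _ (horth k),
      one_mul]
  have A1 : ∀ k i, ∑ i', ∑ r, a k i i' r = 1 := by
    intro k i
    simp_rw [hsum]
    rw [← Complex.re_sum, ← Matrix.trace_sum, hii, Complex.one_re]
  have A2 : ∀ k i', ∑ i, γ i * ∑ r, a k i i' r = γ i' := by
    intro k i'
    have := congrArg Complex.re (hi k i')
    rw [Complex.re_sum] at this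
    simpa [hsum] using this
  have hsum2 : ∀ k i r, ∑ i', a k i i' r =
      (Matrix.trace (outerProj (e k r) * ∑ i', σ k i i')).re := by
    intro k i r
    simp only [hadef]
    rw [Finset.mul_sum, Matrix.trace_sum, Complex.re_sum]
  have A3 : ∀ k i i' r, a k i i' r ≤ (1 + δ ^ 3) * γ i' * ∑ i'', a k i i'' r := by
    intro k i i' r
    have h := tr_nonneg (e k r) _ (hdom k i i')
    rw [mul_sub, Matrix.trace_sub, Matrix.mul_smul, Matrix.trace_smul, smul_eq_mul,
      Complex.sub_re, Complex.re_ofReal_mul, ← hsum2] at h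
    exact sub_nonneg.1 h
  have A4 : ∀ k r, ∑ i, γ i * ∑ i', a k i i' r = lam k r := by
    intro k r
    have h : (Matrix.trace (outerProj (e k r) * ∑ i, (γ i : ℂ) • ∑ i', σ k i i')).re =
        lam k r := by
      rw [hspec, Finset.mul_sum, Matrix.trace_sum, Finset.sum_eq_single r]
      · rw [Matrix.mul_smul, Matrix.trace_smul, trace_outerProj_mul, outerProj,
          Matrix.vecMulVec_mulVec, horth]
        simp [horth]
      · intro q _ hq
        rw [Matrix.mul_smul, Matrix.trace_smul, trace_outerProj_mul, outerProj,
          Matrix.vecMulVec_mulVec, horth]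
        simp [hq, horth]
      · simp
    rw [← h, Finset.mul_sum, Matrix.trace_sum, Complex.re_sum]
    refine Finset.sum_congr rfl fun i _ => ?_
    rw [hsum2, Matrix.mul_smul, Matrix.trace_smul, smul_eq_mul, Complex.re_ofReal_mul]
  have lam0 : ∀ k r, 0 ≤ lam k r := by
    intro k r
    rw [← A4]
    exact Finset.sum_nonneg fun i _ => mul_nonneg (hγ0 i) (Finset.sum_nonneg fun _ _ => ha _ _ _ _)
  have lam1 : ∀ k r, lam k r ≤ 1 := by
    intro k r
    rw [← A4, ← hγ1]
    refine Finset.sum_le_sum fun i _ => ?_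
    calc _ ≤ γ i * 1 := by
          refine mul_le_mul_of_nonneg_left ?_ (hγ0 i)
          rw [← A1 k i]
          exact Finset.sum_le_sum fun i' _ =>
            Finset.single_le_sum (f := fun r => a k i i' r) (fun r _ => ha k i i' r)
              (Finset.mem_univ r)
      _ = _ := mul_one _
  have hf : ∀ k r, 0 ≤ -Real.logb 2 (lam k r) := fun k r =>
    neg_nonneg.2 (Real.logb_nonpos one_lt_two (lam0 k r) (lam1 k r))
  have key := classical_bound γ hγ0 hγ1 (δ ^ 3) (by positivity) a ha lam
    (fun k r => -Real.logb 2 (lam k r)) hf A1 A2 A3 A4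
    (measP γ σ (fun k r => outerProj (e k r))) (fun p => rfl)
  have hS : ∀ k, ∑ r, lam k r * -Real.logb 2 (lam k r) = shannonEntropy (lam k) := by
    intro k
    simp [shannonEntropy]
  have hP0 : ∀ p, 0 ≤ measP γ σ (fun k r => outerProj (e k r)) p := fun p =>
    Finset.sum_nonneg fun i _ => mul_nonneg (hγ0 _) (Finset.prod_nonneg fun k _ => ha k _ _ _)
  simp only [hS, neg_sq, sub_neg_eq_add] at key
  have hV : ∀ k, ∑ q ∈ Finset.univ.filter (fun q : Fin d => 0 < lam k q),
      lam k q * Real.logb 2 (lam k q) ^ 2 = ∑ q, lam k q * Real.logb 2 (lam k q) ^ 2 := by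
    intro k
    refine Finset.sum_subset (Finset.subset_univ _) fun q _ hq => ?_
    have : lam k q = 0 := le_antisymm (by simpa using hq) (lam0 k q)
    simp [this]
  simp_rw [hV]
  rw [Finset.sum_subset (Finset.subset_univ _) (fun p _ hp => by
    have : measP γ σ (fun k r => outerProj (e k r)) p = 0 :=
      le_antisymm (by simpa using hp) (hP0 p)
    rw [this, zero_mul])]
  have hL : ∑ p, measP γ σ (fun k r => outerProj (e k r)) p *
        ((1 / m) * ∑ k, (Real.logb 2 (lam k (p k)) + shannonEntropy (lam k))) ^ 2 =
      (1 / (m : ℝ) ^ 2) * ∑ p, measP γ σ (fun k r => outerProj (e k r)) p *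
        (∑ k, (shannonEntropy (lam k) + Real.logb 2 (lam k (p k)))) ^ 2 := by
    rw [Finset.mul_sum]
    refine Finset.sum_congr rfl fun p _ => ?_
    simp_rw [add_comm (Real.logb 2 _)]
    rw [mul_pow, one_div_pow]
    ring
  rw [hL]
  refine (mul_le_mul_of_nonneg_left key (by positivity)).trans (le_of_eq ?_)
  rw [mul_pow, one_div_pow]
  ring
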